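/- Let k ≥ 1 and let A, M₁, …, M_k, L be real n×n matrices satisfying: (i) A ≤ M₁M₂⋯M_k·L entrywise; (ii) each M_i is a nonsingular M-matrix; (iii) all off-diagonal entries of L are nonpositive; (iv) there exists a nonzero vector e ≥ 0 with Ae ≥ 0 such that at least one of the matrices M₁, …, M_k, L connects N⁰(Ae) with N⁺(Ae). Then L is a nonsingular M-matrix. -/

import Mathlib

/-- A nonsingular M-matrix: a Z-matrix (nonpositive off-diagonal entries) that is
invertible with entrywise nonnegative inverse. -/
def IsNonsingularMMatrix {n : ℕ} (A : Matrix (Fin n) (Fin n) ℝ) : Prop :=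
  (∀ i j, i ≠ j → A i j ≤ 0) ∧ IsUnit A ∧ ∀ i j, 0 ≤ A⁻¹ i j

/-- `B` connects `N1` with `N2`: from every index in `N1` there is a directed path,
along nonzero entries of `B`, ending at some index of `N2`. -/
def Connects {n : ℕ} (B : Matrix (Fin n) (Fin n) ℝ) (N1 N2 : Set (Fin n)) : Prop :=
  ∀ i0 ∈ N1, ∃ r : ℕ, 1 ≤ r ∧ ∃ p : Fin (r + 1) → Fin n,
    p 0 = i0 ∧ p (Fin.last r) ∈ N2 ∧ ∀ k : Fin r, B (p k.castSucc) (p k.succ) ≠ 0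

/-- The set of indices where the vector `v` vanishes. -/
def Nzero {n : ℕ} (v : Fin n → ℝ) : Set (Fin n) := {i | v i = 0}

/-- The set of indices where the vector `v` is positive. -/
def Nplus {n : ℕ} (v : Fin n → ℝ) : Set (Fin n) := {i | 0 < v i}

open Matrix

section ZMatrix

variable {n : ℕ} {B : Matrix (Fin n) (Fin n) ℝ}

/-- Off the diagonal a Z-matrix is nonpositive, so at a zero of `y ≥ 0` all the summands of
`B *ᵥ y` are nonpositive. -/
theorem mul_nonpos_of_apply_eq_zero (hB : ∀ i j, i ≠ j → B i j ≤ 0) {y : Fin n → ℝ} (hy : 0 ≤ y)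
    {i : Fin n} (hi : y i = 0) (j : Fin n) : B i j * y j ≤ 0 := by
  rcases eq_or_ne i j with rfl | h
  · simp [hi]
  · exact mul_nonpos_of_nonpos_of_nonneg (hB i j h) (hy j)

theorem mulVec_nonpos_of_apply_eq_zero (hB : ∀ i j, i ≠ j → B i j ≤ 0) {y : Fin n → ℝ}
    (hy : 0 ≤ y) {i : Fin n} (hi : y i = 0) : (B *ᵥ y) i ≤ 0 := by
  simp only [Matrix.mulVec, dotProduct]
  exact Finset.sum_nonpos fun j _ => mul_nonpos_of_apply_eq_zero hB hy hi j

/-- The zero set of `y` is closed under following the nonzero entries of a Z-matrix `B`, as soon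
as `y ≥ 0` and `B *ᵥ y ≥ 0`. -/
theorem apply_eq_zero_of_entry_ne_zero (hB : ∀ i j, i ≠ j → B i j ≤ 0) {y : Fin n → ℝ}
    (hy : 0 ≤ y) (hBy : 0 ≤ B *ᵥ y) {i j : Fin n} (hi : y i = 0) (hij : B i j ≠ 0) :
    y j = 0 := by
  have hsum : ∑ j, B i j * y j = 0 :=
    le_antisymm (mulVec_nonpos_of_apply_eq_zero hB hy hi) (hBy i)
  have := (Finset.sum_eq_zero_iff_of_nonpos
    fun j _ => mul_nonpos_of_apply_eq_zero hB hy hi j).1 hsum j (Finset.mem_univ j)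
  exact (mul_eq_zero.1 this).resolve_left hij

theorem pos_of_connects (hB : ∀ i j, i ≠ j → B i j ≤ 0) {v y : Fin n → ℝ} (hv : 0 ≤ v)
    (hconn : Connects B (Nzero v) (Nplus v)) (hy : 0 ≤ y) (hBy : 0 ≤ B *ᵥ y)
    (hvy : ∀ i, 0 < v i → 0 < (B *ᵥ y) i) (i : Fin n) : 0 < y i := by
  refine (hy i).lt_of_ne' fun hi => ?_
  have hno : ∀ j, 0 < v j → y j ≠ 0 := fun j hj h =>
    (hvy j hj).not_ge (mulVec_nonpos_of_apply_eq_zero hB hy h)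
  rcases (hv i).eq_or_lt' with h0 | hpos
  · obtain ⟨r, -, p, hp0, hpr, hp⟩ := hconn i h0
    have hzero : ∀ k, y (p k) = 0 := by
      intro k
      induction k using Fin.induction with
      | zero => rwa [hp0]
      | succ k ih => exact apply_eq_zero_of_entry_ne_zero hB hy hBy ih (hp k)
    exact hno _ hpr (hzero _)
  · exact hno i hpos hi

/-- A monotone Z-matrix is a nonsingular M-matrix. -/
theorem isNonsingularMMatrix_of_monotone (hB : ∀ i j, i ≠ j → B i j ≤ 0)
    (hmono : ∀ x, 0 ≤ B *ᵥ x → 0 ≤ x) : IsNonsingularMMatrix B := by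
  have hunit : IsUnit B := by
    rw [← Matrix.mulVec_injective_iff_isUnit, ← Matrix.coe_mulVecLin,
      injective_iff_map_eq_zero]
    intro x hx
    rw [Matrix.mulVecLin_apply] at hx
    refine le_antisymm ?_ (hmono x hx.ge)
    have := hmono (-x) (by rw [Matrix.mulVec_neg, hx, neg_zero])
    exact neg_nonneg.1 this
  refine ⟨hB, hunit, fun i j => ?_⟩
  have hcol : 0 ≤ B⁻¹ *ᵥ Pi.single j 1 := by
    apply hmono
    rw [Matrix.mulVec_mulVec, Matrix.mul_nonsing_inv _ ((Matrix.isUnit_iff_isUnit_det B).1 hunit),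
      Matrix.one_mulVec]
    exact Pi.single_nonneg.2 zero_le_one
  simpa using hcol i

theorem isNonsingularMMatrix_of_connects (hB : ∀ i j, i ≠ j → B i j ≤ 0) {v e : Fin n → ℝ}
    (hv : 0 ≤ v) (hconn : Connects B (Nzero v) (Nplus v)) (he : 0 ≤ e) (hBe : 0 ≤ B *ᵥ e)
    (hve : ∀ i, 0 < v i → 0 < (B *ᵥ e) i) : IsNonsingularMMatrix B := by
  have hepos := pos_of_connects hB hv hconn he hBe hve
  refine isNonsingularMMatrix_of_monotone hB fun x hx => ?_
  by_contra hneg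
  obtain ⟨i₁, hi₁⟩ : ∃ i, x i < 0 := by simpa [Pi.le_def] using hneg
  obtain ⟨i₀, -, hmin⟩ := Finset.exists_min_image Finset.univ (fun i => x i / e i) ⟨i₁, by simp⟩
  set m := x i₀ / e i₀ with hm
  have hmneg : m < 0 :=
    (hmin i₁ (Finset.mem_univ _)).trans_lt (div_neg_of_neg_of_pos hi₁ (hepos i₁))
  have hy : 0 ≤ x - m • e := fun i => by
    have := (le_div_iff₀ (hepos i)).1 (hmin i (Finset.mem_univ i))
    simpa using this
  have hBy : B *ᵥ (x - m • e) = B *ᵥ x + (-m) • B *ᵥ e := by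
    rw [Matrix.mulVec_sub, Matrix.mulVec_smul, neg_smul, sub_eq_add_neg]
  have hmnonneg : 0 ≤ -m := (neg_pos.2 hmneg).le
  have hpos := pos_of_connects hB hv hconn hy (hBy ▸ add_nonneg hx (smul_nonneg hmnonneg hBe))
    (fun i hi => by
      rw [hBy]
      exact add_pos_of_nonneg_of_pos (hx i) (mul_pos (neg_pos.2 hmneg) (hve i hi))) i₀
  have hzero : (x - m • e) i₀ = 0 := by
    simp [hm, div_mul_cancel₀ _ (hepos i₀).ne']
  exact hpos.ne' hzero

end ZMatrix

namespace IsNonsingularMMatrix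

variable {n : ℕ} {M : Matrix (Fin n) (Fin n) ℝ}

theorem nonneg_of_mulVec_nonneg (hM : IsNonsingularMMatrix M) {x : Fin n → ℝ}
    (hx : 0 ≤ M *ᵥ x) : 0 ≤ x := by
  have h : x = M⁻¹ *ᵥ (M *ᵥ x) := by
    rw [Matrix.mulVec_mulVec,
      Matrix.nonsing_inv_mul _ ((Matrix.isUnit_iff_isUnit_det M).1 hM.2.1), Matrix.one_mulVec]
  rw [h]
  intro i
  simp only [Matrix.mulVec, dotProduct, Pi.zero_apply]
  exact Finset.sum_nonneg fun j _ => mul_nonneg (hM.2.2 i j) (hx j)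

theorem pos_of_mulVec_pos (hM : IsNonsingularMMatrix M) {x : Fin n → ℝ} (hx : 0 ≤ M *ᵥ x)
    {i : Fin n} (hi : 0 < (M *ᵥ x) i) : 0 < x i :=
  (hM.nonneg_of_mulVec_nonneg hx i).lt_of_ne' fun h =>
    hi.not_ge (mulVec_nonpos_of_apply_eq_zero hM.1 (hM.nonneg_of_mulVec_nonneg hx) h)

theorem list_prod_nonneg_of_mulVec_nonneg {l : List (Matrix (Fin n) (Fin n) ℝ)}
    (hl : ∀ N ∈ l, IsNonsingularMMatrix N) {x : Fin n → ℝ} (hx : 0 ≤ l.prod *ᵥ x) : 0 ≤ x := by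
  induction l with
  | nil => simpa using hx
  | cons N l ih =>
    rw [List.prod_cons, ← Matrix.mulVec_mulVec] at hx
    exact ih (fun K hK => hl K (List.mem_cons_of_mem _ hK))
      ((hl N List.mem_cons_self).nonneg_of_mulVec_nonneg hx)

theorem list_prod_pos_of_mulVec_pos {l : List (Matrix (Fin n) (Fin n) ℝ)}
    (hl : ∀ N ∈ l, IsNonsingularMMatrix N) {x : Fin n → ℝ} (hx : 0 ≤ l.prod *ᵥ x) {i : Fin n}
    (hi : 0 < (l.prod *ᵥ x) i) : 0 < x i := by
  induction l with
  | nil => simpa using hi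
  | cons N l ih =>
    rw [List.prod_cons, ← Matrix.mulVec_mulVec] at hx hi
    exact ih (fun K hK => hl K (List.mem_cons_of_mem _ hK))
      ((hl N List.mem_cons_self).nonneg_of_mulVec_nonneg hx)
      ((hl N List.mem_cons_self).pos_of_mulVec_pos hx hi)

theorem list_prod_pos_of_connects {l : List (Matrix (Fin n) (Fin n) ℝ)}
    (hl : ∀ N ∈ l, IsNonsingularMMatrix N) (hMl : M ∈ l) {v x : Fin n → ℝ} (hv : 0 ≤ v)
    (hconn : Connects M (Nzero v) (Nplus v)) (hx : 0 ≤ l.prod *ᵥ x)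
    (hvx : ∀ i, 0 < v i → 0 < (l.prod *ᵥ x) i) (i : Fin n) : 0 < x i := by
  induction l with
  | nil => simp at hMl
  | cons N l ih =>
    rw [List.prod_cons, ← Matrix.mulVec_mulVec] at hx hvx
    have hN := hl N List.mem_cons_self
    have hl' : ∀ K ∈ l, IsNonsingularMMatrix K := fun K hK => hl K (List.mem_cons_of_mem _ hK)
    have hnonneg := hN.nonneg_of_mulVec_nonneg hx
    rcases List.mem_cons.1 hMl with rfl | hMl
    · exact list_prod_pos_of_mulVec_pos hl' hnonneg
        (pos_of_connects hN.1 hv hconn hnonneg hx hvx i)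
    · exact ih hl' hMl hnonneg fun j hj => hN.pos_of_mulVec_pos hx (hvx j hj)

end IsNonsingularMMatrix

/-- if `A ≤ M₁⋯M_k L` with each `Mᵢ` a nonsingular M-matrix, `L`
having nonpositive off-diagonal entries, and some `Mᵢ` or `L` connecting `N⁰(Ae)` with
`N⁺(Ae)` for some nonzero `e ≥ 0` with `Ae ≥ 0`, then `L` is a nonsingular M-matrix. -/
theorem stmt7 {n : ℕ} (k : ℕ) (hk : 1 ≤ k)
    (A : Matrix (Fin n) (Fin n) ℝ) (M : Fin k → Matrix (Fin n) (Fin n) ℝ)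
    (L : Matrix (Fin n) (Fin n) ℝ)
    (hle : ∀ i j, A i j ≤ ((List.ofFn M).prod * L) i j)
    (hM : ∀ i, IsNonsingularMMatrix (M i))
    (hL : ∀ i j, i ≠ j → L i j ≤ 0)
    (hconn : ∃ e : Fin n → ℝ, e ≠ 0 ∧ (∀ i, 0 ≤ e i) ∧ (∀ i, 0 ≤ A.mulVec e i) ∧
      ((∃ i, Connects (M i) (Nzero (A.mulVec e)) (Nplus (A.mulVec e))) ∨
        Connects L (Nzero (A.mulVec e)) (Nplus (A.mulVec e)))) :
    IsNonsingularMMatrix L := by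
  obtain ⟨e, -, he, hAe, hconn⟩ := hconn
  have hl : ∀ N ∈ List.ofFn M, IsNonsingularMMatrix N := by
    simpa [List.mem_ofFn] using hM
  have hw : A *ᵥ e ≤ (List.ofFn M).prod *ᵥ (L *ᵥ e) := fun i => by
    rw [Matrix.mulVec_mulVec]
    simp only [Matrix.mulVec, dotProduct]
    exact Finset.sum_le_sum fun j _ => mul_le_mul_of_nonneg_right (hle i j) (he j)
  have hw0 : 0 ≤ (List.ofFn M).prod *ᵥ (L *ᵥ e) := le_trans hAe hw
  have hwpos : ∀ i, 0 < (A *ᵥ e) i → 0 < ((List.ofFn M).prod *ᵥ (L *ᵥ e)) i :=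
    fun i hi => hi.trans_le (hw i)
  have hLe := IsNonsingularMMatrix.list_prod_nonneg_of_mulVec_nonneg hl hw0
  rcases hconn with ⟨i, hi⟩ | hconn
  · have hpos := IsNonsingularMMatrix.list_prod_pos_of_connects hl (List.mem_ofFn.2 ⟨i, rfl⟩)
      hAe hi hw0 hwpos
    exact isNonsingularMMatrix_of_connects hL hLe (fun j hj => absurd hj (hpos j).ne') he hLe
      fun _ => id
  · exact isNonsingularMMatrix_of_connects hL hAe hconn he hLe fun i hi =>
      IsNonsingularMMatrix.list_prod_pos_of_mulVec_pos hl hw0 (hwpos i hi)
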